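/- If the vectors Mⁿ · Φ converge to the zero vector of ℂ^(d·d) as n → ∞, then the program scheme is almost terminating, i.e. for every density matrix ρ one has tr(E₁(Gⁿ⁻¹(ρ))) → 0 as n → ∞. -/

import Mathlib

open Matrix Kronecker Filter Topology
open scoped ComplexOrder

/-- The completely positive map `X ↦ ∑ i, K i * X * (K i)ᴴ` with Kraus operators `K`. -/
def krausMap {n ι : Type*} [Fintype n] [Fintype ι] (K : ι → Matrix n n ℂ) :
    Matrix n n ℂ →ₗ[ℂ] Matrix n n ℂ where
  toFun X := ∑ i, K i * X * (K i)ᴴ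
  map_add' X Y := by simp [Matrix.mul_add, Matrix.add_mul, Finset.sum_add_distrib]
  map_smul' c X := by simp [Finset.smul_sum]

section KrausMap

variable {n ι : Type*} [Fintype n] [Fintype ι] (K : ι → Matrix n n ℂ)

lemma krausMap_apply (X : Matrix n n ℂ) : krausMap K X = ∑ i, K i * X * (K i)ᴴ := rfl

lemma posSemidef_krausMap {X : Matrix n n ℂ} (hX : X.PosSemidef) :
    (krausMap K X).PosSemidef :=
  posSemidef_sum _ fun i _ => hX.mul_mul_conjTranspose_same (K i)

lemma posSemidef_krausMap_iterate {X : Matrix n n ℂ} (hX : X.PosSemidef) (m : ℕ) :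
    ((krausMap K)^[m] X).PosSemidef := by
  induction m with
  | zero => exact hX
  | succ m ih =>
    rw [Function.iterate_succ_apply']
    exact posSemidef_krausMap K ih

/-- The matrix representation of a Kraus map acts on vectorized matrices as the map itself. -/
lemma sum_kronecker_conj_mulVec (X : Matrix n n ℂ) :
    (∑ i, K i ⊗ₖ (K i).map (starRingEnd ℂ)) *ᵥ (fun p : n × n => X p.1 p.2) =
      fun p => krausMap K X p.1 p.2 := by
  ext p
  simp only [krausMap_apply, Matrix.sum_mulVec, Finset.sum_apply, Matrix.sum_apply]
  refine Finset.sum_congr rfl fun i _ => ?_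
  simp only [mulVec, dotProduct, kroneckerMap_apply, map_apply, Matrix.mul_apply,
    conjTranspose_apply, Fintype.sum_prod_type, Finset.sum_mul, starRingEnd_apply]
  rw [Finset.sum_comm]
  exact Finset.sum_congr rfl fun _ _ => Finset.sum_congr rfl fun _ _ => by ring

lemma sum_kronecker_conj_pow_mulVec [DecidableEq n] (X : Matrix n n ℂ) (m : ℕ) :
    (∑ i, K i ⊗ₖ (K i).map (starRingEnd ℂ)) ^ m *ᵥ (fun p : n × n => X p.1 p.2) =
      fun p => (krausMap K)^[m] X p.1 p.2 := by
  induction m with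
  | zero => simp
  | succ m ih =>
    rw [pow_succ', ← mulVec_mulVec, ih, sum_kronecker_conj_mulVec, Function.iterate_succ_apply']

/-- Composing a trace-preserving map with conjugation by `A` does not change the trace. -/
lemma trace_krausMap_mul [DecidableEq n] (hK : ∑ i, (K i)ᴴ * K i = 1) (A X : Matrix n n ℂ) :
    (krausMap (fun i => K i * A) X).trace = (A * X * Aᴴ).trace := by
  have key (i : ι) : (K i * A * X * (K i * A)ᴴ).trace = ((K i)ᴴ * K i * (A * X * Aᴴ)).trace := by
    rw [conjTranspose_mul, ← Matrix.mul_assoc, trace_mul_comm]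
    simp only [Matrix.mul_assoc]
  simp only [krausMap_apply, trace_sum, key]
  rw [← trace_sum, ← Finset.sum_mul, hK, one_mul]

end KrausMap

open scoped MatrixOrder Matrix.Norms.L2Operator in
lemma Matrix.PosSemidef.exists_posSemidef_smul_one_sub {n : Type*} [Fintype n] [DecidableEq n]
    {A : Matrix n n ℂ} (hA : A.PosSemidef) : ∃ c : ℂ, (c • 1 - A).PosSemidef := by
  refine ⟨(‖A‖ : ℝ), ?_⟩
  have hle := IsSelfAdjoint.le_algebraMap_norm_self (a := A) hA.isHermitian
  rw [Matrix.le_iff, Algebra.algebraMap_eq_smul_one] at hle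
  simpa using hle

theorem stmt17 (d : ℕ) (hd : 0 < d) (ι : Type) [Fintype ι]
    (E : ι → Matrix (Fin d) (Fin d) ℂ) (hE : ∑ i, (E i)ᴴ * E i = 1)
    (M0 M1 : Matrix (Fin d) (Fin d) ℂ) (hM : M0ᴴ * M0 + M1ᴴ * M1 = 1)
    (h : Tendsto (fun n => ((∑ i, (E i * M1) ⊗ₖ (E i * M1).map (starRingEnd ℂ)) ^ n) *ᵥ (fun p : Fin d × Fin d => if p.1 = p.2 then (1 : ℂ) else 0)) atTop (nhds (0 : Fin d × Fin d → ℂ))) :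
    ∀ ρ : Matrix (Fin d) (Fin d) ℂ, ρ.PosSemidef → ρ.trace = 1 →
      Tendsto (fun n => (M1 * ((fun ρ : Matrix (Fin d) (Fin d) ℂ => ∑ i, (E i * M1) * ρ * (E i * M1)ᴴ)^[n - 1] ρ) * M1ᴴ).trace) atTop (nhds 0) := by
  intro ρ hρ _
  set G := krausMap (fun i => E i * M1) with hG
  change Tendsto (fun n => (M1 * (G^[n - 1] ρ) * M1ᴴ).trace) atTop (𝓝 0)
  have hone : Tendsto (fun n => (G^[n] 1).trace) atTop (𝓝 0) := by
    have hentry (i : Fin d) : Tendsto (fun n => (G^[n] 1) i i) atTop (𝓝 0) := by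
      refine (tendsto_pi_nhds.1 h (i, i)).congr fun n => ?_
      exact congrFun (sum_kronecker_conj_pow_mulVec (fun i => E i * M1) 1 n) (i, i)
    simpa [trace] using tendsto_finsetSum Finset.univ fun i _ => hentry i
  obtain ⟨c, hc⟩ := hρ.exists_posSemidef_smul_one_sub
  have hle (n : ℕ) : (G^[n] ρ).trace ≤ c * (G^[n] 1).trace := by
    have hpos := (posSemidef_krausMap_iterate (fun i => E i * M1) hc n).trace_nonneg
    rw [← hG, ← Module.End.coe_pow, map_sub, map_smul, trace_sub, trace_smul,
      sub_nonneg] at hpos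
    simpa only [Module.End.coe_pow, smul_eq_mul] using hpos
  have hnonneg (n : ℕ) : 0 ≤ (G^[n] ρ).trace :=
    (posSemidef_krausMap_iterate (fun i => E i * M1) hρ n).trace_nonneg
  have hlim : Tendsto (fun n => (G^[n] ρ).trace) atTop (𝓝 0) := by
    refine squeeze_zero_norm (a := fun n => ‖c * (G^[n] 1).trace‖) (fun n => ?_) ?_
    · exact CStarAlgebra.norm_le_norm_of_nonneg_of_le (hnonneg n) (hle n)
    · simpa using (hone.const_mul c).norm
  refine hlim.congr' ?_
  filter_upwards [eventually_ge_atTop 1] with n hn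
  obtain ⟨m, rfl⟩ := Nat.exists_eq_add_of_le' hn
  rw [Function.iterate_succ_apply', hG, trace_krausMap_mul E hE, Nat.add_sub_cancel]
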